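/- Let (V, ‖·‖) be a real normed vector space whose metric satisfies the Ptolemy inequality: for all x, y, z, u ∈ V, ‖x − z‖·‖y − u‖ ≤ ‖x − y‖·‖z − u‖ + ‖x − u‖·‖y − z‖. Then the norm comes from an inner product, i.e., the parallelogram law ‖x + y‖² + ‖x − y‖² = 2‖x‖² + 2‖y‖² holds for all x, y ∈ V. -/

import Mathlib

/-- A closed set of reals closed under midpoints contains the intervals between its points. -/
lemma interval_of_midpoint (A : Set ℝ) (hA : IsClosed A) (a0 b0 : ℝ) (ha : a0 ∈ A) (hb : b0 ∈ A)
    (hm : ∀ a ∈ A, ∀ b ∈ A, a0 ≤ a → a < b → b ≤ b0 → (a + b) / 2 ∈ A)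
    (t : ℝ) (h1 : a0 ≤ t) (h2 : t ≤ b0) : t ∈ A := by
  have c1 : IsCompact (A ∩ Set.Icc a0 t) := isCompact_Icc.inter_left hA
  have c2 : IsCompact (A ∩ Set.Icc t b0) := isCompact_Icc.inter_left hA
  obtain ⟨a, ⟨haA, ha1, ha2⟩, hamax⟩ := c1.exists_isGreatest ⟨a0, ha, le_refl _, h1⟩
  obtain ⟨b, ⟨hbA, hb1, hb2⟩, hbmin⟩ := c2.exists_isLeast ⟨b0, hb, h2, le_refl _⟩
  by_contra ht
  have hat : a < t := lt_of_le_of_ne ha2 (by rintro rfl; exact ht haA)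
  have htb : t < b := lt_of_le_of_ne hb1 (by rintro rfl; exact ht hbA)
  have hmA := hm a haA b hbA ha1 (hat.trans htb) hb2
  rcases le_total ((a + b) / 2) t with h | h
  · have := hamax ⟨hmA, by linarith, h⟩
    linarith
  · have := hbmin ⟨hmA, h, by linarith⟩
    linarith

section
variable {V : Type*} [NormedAddCommGroup V] [NormedSpace ℝ V]

/-- Orthonormal case. -/
lemma circle_case (P : ∀ p q : V, 4 * (‖p‖ * ‖q‖) ≤ ‖p + q‖ ^ 2 + ‖p - q‖ ^ 2)
    (e f : V) (he : ‖e‖ = 1) (hf : ‖f‖ = 1)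
    (hQ : ∀ a b : ℝ, ‖a • e + b • f‖ ^ 2 ≤ a ^ 2 + b ^ 2) (a b : ℝ) :
    ‖a • e + b • f‖ ^ 2 = a ^ 2 + b ^ 2 := by
  set u : ℝ → V := fun t => Real.cos t • e + Real.sin t • f with hu
  set A : Set ℝ := {t | ‖u t‖ = 1} with hAdef
  have hcl : IsClosed A := by
    apply isClosed_eq _ continuous_const
    fun_prop
  have hmid : ∀ s ∈ A, ∀ t ∈ A, s < t → t < s + Real.pi → (s + t) / 2 ∈ A := by
    intro s hs t ht hst hst2
    have hs' : ‖u s‖ = 1 := hs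
    have ht' : ‖u t‖ = 1 := ht
    set m := (s + t) / 2 with hm
    set d := (t - s) / 2 with hd
    have es : s = m - d := by rw [hm, hd]; ring
    have et : t = m + d := by rw [hm, hd]; ring
    have hp : u s + u t = (2 * Real.cos d) • u m := by
      simp only [hu]
      rw [es, et, Real.cos_sub, Real.cos_add, Real.sin_sub, Real.sin_add]
      module
    have hq : u s - u t = (2 * Real.sin d * Real.sin m) • e + (-(2 * Real.sin d * Real.cos m)) • f := by
      simp only [hu]
      rw [es, et, Real.cos_sub, Real.cos_add, Real.sin_sub, Real.sin_add]
      module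
    have h1 := P (u s) (u t)
    rw [hs', ht', hp, norm_smul, mul_pow, Real.norm_eq_abs, sq_abs, hq] at h1
    have h2 := hQ (2 * Real.sin d * Real.sin m) (-(2 * Real.sin d * Real.cos m))
    have h3 := hQ (Real.cos m) (Real.sin m)
    have h3' : ‖u m‖ ^ 2 ≤ 1 := by
      have := Real.sin_sq_add_cos_sq m
      simp only [hu]; linarith
    have h4 : (2 * Real.sin d * Real.sin m) ^ 2 + (-(2 * Real.sin d * Real.cos m)) ^ 2
        = 4 * Real.sin d ^ 2 := by
      have := Real.sin_sq_add_cos_sq m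
      linear_combination 4 * Real.sin d ^ 2 * this
    have h5 := Real.sin_sq_add_cos_sq d
    have h6 : 0 < Real.cos d := Real.cos_pos_of_mem_Ioo ⟨by linarith, by linarith⟩
    have h7 : 0 < Real.cos d ^ 2 := by positivity
    have h8 : 1 ≤ ‖u m‖ ^ 2 := by
      by_contra hlt
      push Not at hlt
      nlinarith
    have h9 : ‖u m‖ ^ 2 = 1 := le_antisymm h3' h8
    have h10 := norm_nonneg (u m)
    show ‖u m‖ = 1
    nlinarith
  have hpi := Real.pi_pos
  have k0 : (0 : ℝ) ∈ A := by simp [hAdef, hu, he]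
  have k1 : Real.pi / 2 ∈ A := by simp [hAdef, hu, hf]
  have k2 : Real.pi ∈ A := by simp [hAdef, hu, he]
  have k3 : -(Real.pi / 2) ∈ A := by simp [hAdef, hu, hf]
  have k4 : -Real.pi ∈ A := by simp [hAdef, hu, he]
  have key : ∀ a0 ∈ A, a0 + Real.pi / 2 ∈ A → ∀ t, a0 ≤ t → t ≤ a0 + Real.pi / 2 → t ∈ A := by
    intro a0 h0 h1 t ht1 ht2
    refine interval_of_midpoint A hcl a0 _ h0 h1 ?_ t ht1 ht2
    intro s hs t ht q1 q2 q3
    exact hmid s hs t ht q2 (by linarith)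
  have all : ∀ t, -Real.pi ≤ t → t ≤ Real.pi → t ∈ A := by
    intro t h1 h2
    rcases le_total t 0 with h | h
    · rcases le_total t (-(Real.pi / 2)) with h' | h'
      · exact key (-Real.pi) k4 (by convert k3 using 1; ring) t h1 (by linarith)
      · exact key _ k3 (by convert k0 using 1; ring) t h' (by linarith)
    · rcases le_total t (Real.pi / 2) with h' | h'
      · exact key _ k0 (by convert k1 using 1; ring) t h (by linarith)
      · exact key _ k1 (by convert k2 using 1; ring) t h' (by linarith)
  set z : ℂ := ⟨a, b⟩ with hz
  have hA : ‖u z.arg‖ = 1 := all z.arg (Complex.neg_pi_lt_arg z).le (Complex.arg_le_pi z)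
  have ea : ‖z‖ * Real.cos z.arg = a := Complex.norm_mul_cos_arg z
  have eb : ‖z‖ * Real.sin z.arg = b := Complex.norm_mul_sin_arg z
  have e1 : a • e + b • f = ‖z‖ • u z.arg := by
    simp only [hu]
    rw [smul_add, smul_smul, smul_smul, ea, eb]
  rw [e1, norm_smul, hA, ← ea, ← eb]
  have := Real.sin_sq_add_cos_sq z.arg
  rw [norm_norm]
  linear_combination -‖z‖ ^ 2 * this

/-- Two contact points: the norm is Euclidean on the span. -/
lemma two_contacts (P : ∀ p q : V, 4 * (‖p‖ * ‖q‖) ≤ ‖p + q‖ ^ 2 + ‖p - q‖ ^ 2)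
    (u z : V) (hu : ‖u‖ = 1) (hz : ‖z‖ = 1) (c : ℝ) (h1 : u + z ≠ 0) (h2 : u - z ≠ 0)
    (hQ : ∀ a b : ℝ, ‖a • u + b • z‖ ^ 2 ≤ a ^ 2 + 2 * c * a * b + b ^ 2) (a b : ℝ) :
    ‖a • u + b • z‖ ^ 2 = a ^ 2 + 2 * c * a * b + b ^ 2 := by
  have p := P u z
  rw [hu, hz] at p
  have q1 := hQ 1 1
  have q2 := hQ 1 (-1)
  have w1 : (1 : ℝ) • u + (1 : ℝ) • z = u + z := by module
  have w2 : (1 : ℝ) • u + (-1 : ℝ) • z = u - z := by module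
  rw [w1] at q1
  rw [w2] at q2
  set m := ‖u + z‖ with hm
  set n := ‖u - z‖ with hn
  have mp : 0 < m := norm_pos_iff.2 h1
  have np : 0 < n := norm_pos_iff.2 h2
  have m2 : m ^ 2 = 2 + 2 * c := by linarith
  have n2 : n ^ 2 = 2 - 2 * c := by linarith
  have hC := circle_case P (m⁻¹ • (u + z)) (n⁻¹ • (u - z))
    (by rw [norm_smul, ← hm, Real.norm_eq_abs, abs_of_pos (by positivity)]; field_simp)
    (by rw [norm_smul, ← hn, Real.norm_eq_abs, abs_of_pos (by positivity)]; field_simp)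
    (by
      intro s t
      have e : s • m⁻¹ • (u + z) + t • n⁻¹ • (u - z)
        = (s * m⁻¹ + t * n⁻¹) • u + (s * m⁻¹ - t * n⁻¹) • z := by module
      rw [e]
      refine (hQ _ _).trans (le_of_eq ?_)
      have i1 : m⁻¹ ^ 2 * (2 + 2 * c) = 1 := by rw [← m2]; field_simp
      have i2 : n⁻¹ ^ 2 * (2 - 2 * c) = 1 := by rw [← n2]; field_simp
      linear_combination s ^ 2 * i1 + t ^ 2 * i2)
    (m * ((a + b) / 2)) (n * ((a - b) / 2))
  have e : (m * ((a + b) / 2)) • m⁻¹ • (u + z) + (n * ((a - b) / 2)) • n⁻¹ • (u - z)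
      = a • u + b • z := by
    rw [smul_smul, smul_smul, mul_comm m, mul_comm n, mul_assoc, mul_assoc,
      mul_inv_cancel₀ mp.ne', mul_inv_cancel₀ np.ne']
    module
  rw [e] at hC
  rw [hC]
  linear_combination ((a + b) / 2) ^ 2 * m2 + ((a - b) / 2) ^ 2 * n2

/-- The optimal ellipse. -/
lemma ellipse (P : ∀ p q : V, 4 * (‖p‖ * ‖q‖) ≤ ‖p + q‖ ^ 2 + ‖p - q‖ ^ 2)
    (x v : V) (hx : ‖x‖ = 1) (hlow : ∀ t : ℝ, 1 ≤ ‖x + t • v‖) :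
    ∃ k s : ℝ, (∀ a b : ℝ, ‖a • x + b • v‖ ^ 2 ≤ a ^ 2 + k * b ^ 2) ∧
      ‖s • x - v‖ ^ 2 = s ^ 2 + k := by
  set c := ‖v‖ with hc
  have c0 : 0 ≤ c := norm_nonneg v
  have up1 : ∀ t : ℝ, ‖x + t • v‖ ≤ 1 + c ^ 2 * t ^ 2 := by
    intro t
    have p := P (x + t • v) (x + (-t) • v)
    have e1 : x + t • v + (x + (-t) • v) = (2 : ℝ) • x := by module
    have e2 : x + t • v - (x + (-t) • v) = (2 * t) • v := by module
    rw [e1, e2, norm_smul, norm_smul, hx, ← hc, mul_pow, mul_pow, Real.norm_eq_abs,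
      Real.norm_eq_abs, sq_abs, sq_abs] at p
    nlinarith [hlow t, hlow (-t)]
  have up2 : ∀ t : ℝ, ‖x + t • v‖ ≤ 1 + c * |t| := by
    intro t
    have := norm_add_le x (t • v)
    rw [norm_smul, hx, Real.norm_eq_abs, ← hc] at this
    linarith
  set S : Set ℝ := (fun t : ℝ => (‖x + t • v‖ ^ 2 - 1) / t ^ 2) '' {t | t ≠ 0} with hS
  have hbdd : BddAbove S := by
    refine ⟨2 * c ^ 2 + c ^ 4 + 2 * c, ?_⟩
    rintro _ ⟨t, ht, rfl⟩
    have ht : t ≠ 0 := ht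
    have t2 : 0 < t ^ 2 := by positivity
    rw [div_le_iff₀ t2]
    have l := hlow t
    rcases le_total |t| 1 with h | h
    · have h' : t ^ 2 ≤ 1 := by rw [← sq_abs]; nlinarith [abs_nonneg t]
      have : ‖x + t • v‖ ^ 2 ≤ (1 + c ^ 2 * t ^ 2) ^ 2 := by
        gcongr; exact up1 t
      have h4 : c ^ 4 * (t ^ 2 * t ^ 2) ≤ c ^ 4 * (1 * t ^ 2) := by gcongr
      nlinarith [mul_nonneg c0 t2.le]
    · have h' : |t| ≤ t ^ 2 := by rw [← sq_abs]; nlinarith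
      have : ‖x + t • v‖ ^ 2 ≤ (1 + c * |t|) ^ 2 := by
        gcongr; exact up2 t
      have h5 : c * |t| ≤ c * t ^ 2 := by gcongr
      have h6 : 0 ≤ c ^ 4 * t ^ 2 := by positivity
      have h7 : 0 ≤ c ^ 2 * t ^ 2 := by positivity
      have h8 : (1 + c * |t|) ^ 2 = 1 + 2 * (c * |t|) + c ^ 2 * t ^ 2 := by
        rw [← sq_abs t]; ring
      nlinarith
  have hne : S.Nonempty := ⟨_, 1, one_ne_zero, rfl⟩
  set k := sSup S with hk
  have hle : ∀ t : ℝ, ‖x + t • v‖ ^ 2 ≤ 1 + k * t ^ 2 := by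
    intro t
    by_cases ht : t = 0
    · simp [ht, hx]
    · have t2 : 0 < t ^ 2 := by positivity
      have := le_csSup hbdd ⟨t, ht, rfl⟩
      rw [← hk] at this
      simp only at this
      rw [div_le_iff₀ t2] at this
      linarith
  have k0 : 0 ≤ k := by
    have h1 := hle 1
    have h2 := hlow 1
    nlinarith
  have hQ : ∀ a b : ℝ, ‖a • x + b • v‖ ^ 2 ≤ a ^ 2 + k * b ^ 2 := by
    intro a b
    have hcl : IsClosed {a : ℝ | ‖a • x + b • v‖ ^ 2 ≤ a ^ 2 + k * b ^ 2} := by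
      apply isClosed_le <;> fun_prop
    have hsub : ({0}ᶜ : Set ℝ) ⊆ {a : ℝ | ‖a • x + b • v‖ ^ 2 ≤ a ^ 2 + k * b ^ 2} := by
      intro a ha
      have ha : a ≠ 0 := ha
      have e : a • x + b • v = a • (x + (b / a) • v) := by
        rw [smul_add, smul_smul, mul_div_cancel₀ _ ha]
      show ‖a • x + b • v‖ ^ 2 ≤ a ^ 2 + k * b ^ 2
      rw [e, norm_smul, mul_pow, Real.norm_eq_abs, sq_abs]
      have h1 : a ^ 2 * ‖x + (b / a) • v‖ ^ 2 ≤ a ^ 2 * (1 + k * (b / a) ^ 2) := by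
        gcongr; exact hle _
      refine h1.trans (le_of_eq ?_)
      field_simp
    have hd : Dense ({0}ᶜ : Set ℝ) := dense_compl_singleton 0
    exact hcl.closure_subset_iff.2 hsub (hd a)
  refine ⟨k, ?_⟩
  -- defect function on a compact interval
  set D : ℝ → ℝ := fun s => s ^ 2 + k - ‖s • x - v‖ ^ 2 with hD
  have hDc : Continuous D := by fun_prop
  have hD0 : ∀ s, 0 ≤ D s := by
    intro s
    have := hQ s (-1)
    have e : s • x + (-1 : ℝ) • v = s • x - v := by module
    rw [e] at this
    simp only [hD]; linarith
  obtain ⟨s, hs, hmin⟩ := (isCompact_Icc (a := -√k) (b := √k)).exists_isMinOn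
    ⟨0, by simp, by simp⟩ hDc.continuousOn
  refine ⟨s, hQ, ?_⟩
  have : D s ≤ 0 := by
    apply le_of_forall_pos_le_add
    intro ε hε
    obtain ⟨_, ⟨t, ht, rfl⟩, hlt⟩ := exists_lt_of_lt_csSup hne (show k - ε / 4 < sSup S by linarith)
    have ht : t ≠ 0 := ht
    have t2 : 0 < t ^ 2 := by positivity
    simp only at hlt
    rw [lt_div_iff₀ t2] at hlt
    set w := x + t • v with hw
    set r := √(1 + k * t ^ 2) with hr
    have r2 : r ^ 2 = 1 + k * t ^ 2 := Real.sq_sqrt (by positivity)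
    have r1 : 1 ≤ r := by
      rw [hr]; apply Real.one_le_sqrt.2; nlinarith
    have p := P (r • x) w
    have e1 : r • x + w = (r + 1) • x + t • v := by rw [hw]; module
    have e2 : r • x - w = t • (((r - 1) / t) • x - v) := by
      rw [hw, smul_sub, smul_smul, mul_div_cancel₀ _ ht]; module
    have q1 := hQ (r + 1) t
    rw [e1, e2, norm_smul, norm_smul, hx, mul_pow, Real.norm_eq_abs, Real.norm_eq_abs, sq_abs,
      abs_of_nonneg (by linarith)] at p
    have hwr : ‖w‖ ≤ r := by
      apply Real.le_sqrt_of_sq_le; exact hle t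
    have hw0 := norm_nonneg w
    have hmem : (r - 1) / t ∈ Set.Icc (-√k) (√k) := by
      rw [Set.mem_Icc, ← abs_le, abs_div, div_le_iff₀ (abs_pos.2 ht), abs_of_nonneg (by linarith)]
      have sk := Real.sq_sqrt k0
      have a0 : 0 ≤ √k * |t| := by positivity
      have : r ^ 2 ≤ (1 + √k * |t|) ^ 2 := by
        have : (√k * |t|) ^ 2 = k * t ^ 2 := by rw [mul_pow, sk, sq_abs]
        nlinarith
      have := abs_le_of_sq_le_sq' this (by linarith)
      linarith [this.2]
    have hm := hmin hmem
    have hm : D s ≤ D ((r - 1) / t) := hm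
    refine hm.trans ?_
    have hDt : t ^ 2 * D ((r - 1) / t) = (r - 1) ^ 2 + k * t ^ 2
        - t ^ 2 * ‖((r - 1) / t) • x - v‖ ^ 2 := by
      simp only [hD]; field_simp
    have h1 : t ^ 2 * D ((r - 1) / t) ≤ 4 * r ^ 2 - 4 * (r * ‖w‖) := by
      rw [hDt]; nlinarith
    have h2 : t ^ 2 * D ((r - 1) / t) ≤ t ^ 2 * ε := by
      nlinarith
    have := le_of_mul_le_mul_left h2 t2
    linarith
  have h3 := hD0 s
  simp only [hD] at this h3
  linarith

end

/-- Schoenberg's theorem: a real normed vector space satisfying the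
Ptolemy inequality satisfies the parallelogram law, hence is an inner product space. -/
theorem schoenberg_ptolemy_implies_parallelogram
    {V : Type*} [NormedAddCommGroup V] [NormedSpace ℝ V]
    (hpt : ∀ x y z u : V,
      ‖x - z‖ * ‖y - u‖ ≤ ‖x - y‖ * ‖z - u‖ + ‖x - u‖ * ‖y - z‖) :
    ∀ x y : V, ‖x + y‖ ^ 2 + ‖x - y‖ ^ 2 = 2 * ‖x‖ ^ 2 + 2 * ‖y‖ ^ 2 := by
  have P : ∀ p q : V, 4 * (‖p‖ * ‖q‖) ≤ ‖p + q‖ ^ 2 + ‖p - q‖ ^ 2 := by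
    intro p q
    have h := hpt p q (-p) (-q)
    have e1 : p - -p = (2 : ℝ) • p := by module
    have e2 : q - -q = (2 : ℝ) • q := by module
    have e3 : -p - -q = -(p - q) := by abel
    have e4 : p - -q = p + q := by abel
    have e5 : q - -p = p + q := by abel
    rw [e1, e2, e3, e4, e5, norm_neg, norm_smul, norm_smul, Real.norm_eq_abs, abs_two] at h
    linarith
  intro x0 y
  by_cases hx0 : x0 = 0
  · simp [hx0]; ring
  set n := ‖x0‖ with hn
  have npos : 0 < n := norm_pos_iff.2 hx0
  set x := n⁻¹ • x0 with hxdef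
  have hx : ‖x‖ = 1 := by
    rw [hxdef, norm_smul, ← hn, Real.norm_eq_abs, abs_of_pos (by positivity)]; field_simp
  have hx0x : x0 = n • x := by
    rw [hxdef, smul_smul, mul_inv_cancel₀ npos.ne', one_smul]
  clear_value x
  obtain ⟨φ, hφ, hφx⟩ := exists_dual_vector'' ℝ x
  have hφx : φ x = 1 := by rw [hφx, hx]; rfl
  set v := y - (φ y) • x with hv
  have hφv : φ v = 0 := by rw [hv, map_sub, map_smul, hφx]; simp
  have hy : y = (φ y) • x + v := by rw [hv]; abel
  clear_value v
  by_cases hv0 : v = 0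
  · have hy' : y = (φ y) • x := by rw [hv0] at hy; simpa using hy
    rw [hn, hy', hx0x, ← add_smul, ← sub_smul]
    simp only [norm_smul, hx, Real.norm_eq_abs, mul_one, sq_abs]
    ring
  have hlow : ∀ t : ℝ, 1 ≤ ‖x + t • v‖ := by
    intro t
    have h1 := φ.le_opNorm (x + t • v)
    rw [map_add, map_smul, hφx, hφv] at h1
    simp at h1
    nlinarith [norm_nonneg (x + t • v)]
  obtain ⟨k, s, hQ, hs⟩ := ellipse P x v hx hlow
  have indep : ∀ a b : ℝ, b ≠ 0 → a • x + b • v ≠ 0 := by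
    intro a b hb h
    have h1 := congrArg φ h
    rw [map_add, map_smul, map_smul, hφx, hφv] at h1
    simp at h1
    rw [h1] at h
    simp [hb, hv0] at h
  set l := ‖s • x - v‖ with hl
  have lpos : 0 < l := by
    apply norm_pos_iff.2
    have := indep s (-1) (by norm_num)
    convert this using 1
    module
  set z := l⁻¹ • (s • x - v) with hz
  have hz1 : ‖z‖ = 1 := by
    rw [hz, norm_smul, ← hl, Real.norm_eq_abs, abs_of_pos (by positivity)]; field_simp
  have hli : l⁻¹ ≠ 0 := by positivity
  have il : l⁻¹ ^ 2 * (s ^ 2 + k) = 1 := by rw [← hs]; field_simp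
  have H := two_contacts P x z hx hz1 (l⁻¹ * s)
    (by
      have := indep (1 + l⁻¹ * s) (-l⁻¹) (by simpa using hli)
      convert this using 1
      rw [hz]; module)
    (by
      have := indep (1 - l⁻¹ * s) (l⁻¹) hli
      convert this using 1
      rw [hz]; module)
    (by
      intro a b
      have e : a • x + b • z = (a + b * l⁻¹ * s) • x + (-(b * l⁻¹)) • v := by rw [hz]; module
      rw [e]
      refine (hQ _ _).trans (le_of_eq ?_)
      linear_combination b ^ 2 * il)
  have hvz : v = s • x - l • z := by
    rw [hz, smul_smul, mul_inv_cancel₀ lpos.ne']; module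
  have hy2 : y = (φ y + s) • x + (-l) • z := by
    rw [hvz] at hy
    refine hy.trans ?_
    module
  generalize φ y + s = α at hy2
  generalize -l = β at hy2
  have g1 : x0 + y = (n + α) • x + β • z := by rw [hx0x, hy2]; module
  have g2 : x0 - y = (n - α) • x + (-β) • z := by rw [hx0x, hy2]; module
  rw [g1, g2, hy2, H, H, H]
  ring
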